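/- Let (Z, 𝒜, P) be a probability space, λ > 0, and let l : ℝ^d × Z → ℝ be measurable in z and twice continuously differentiable in θ, with uniform bounds |l(θ,z)| ≤ M, ‖∇_θ l(θ,z)‖ ≤ G, and ‖∇²_θ l(θ,z)‖ ≤ L (operator norm) for all θ, z. Then the gradient of f(θ) = log ∫ exp( l(θ, z)/λ ) dP(z) is Lipschitz continuous with Lipschitz constant L' = L/λ + G²/λ²; that is, ‖∇f(θ₁) − ∇f(θ₂)‖ ≤ (L/λ + G²/λ²) ‖θ₁ − θ₂‖ for all θ₁, θ₂ ∈ ℝ^d. -/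

import Mathlib

open MeasureTheory Real

lemma aux_meas_deriv {Z : Type*} [MeasurableSpace Z] (h : ℝ → Z → ℝ) (h' : Z → ℝ) (t : ℝ)
    (hm : ∀ t, Measurable (h t)) (hd : ∀ z, HasDerivAt (fun s => h s z) (h' z) t) :
    Measurable h' := by
  have hseq : Filter.Tendsto (fun n : ℕ => (1 : ℝ) / ((n : ℝ) + 1)) Filter.atTop
      (nhdsWithin 0 (Set.Ioi 0)) := by
    rw [tendsto_nhdsWithin_iff]
    refine ⟨tendsto_one_div_add_atTop_nhds_zero_nat, Filter.Eventually.of_forall fun n => ?_⟩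
    simp only [Set.mem_Ioi]
    positivity
  refine measurable_of_tendsto_metrizable
    (f := fun (n : ℕ) z => ((1 : ℝ) / ((n : ℝ) + 1))⁻¹ • (h (t + 1 / ((n : ℝ) + 1)) z - h t z))
    (fun n => ?_) ?_
  · simp only [smul_eq_mul]
    exact ((hm _).sub (hm _)).const_mul _
  · rw [tendsto_pi_nhds]
    intro z
    exact (hd z).tendsto_slope_zero_right.comp hseq

lemma aux_int {Z : Type*} [MeasurableSpace Z] (P : Measure Z) [IsFiniteMeasure P]
    (X : Z → ℝ) (hX : Measurable X) (K : ℝ) (h : ∀ z, |X z| ≤ K) : Integrable X P :=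
  Integrable.of_bound hX.aestronglyMeasurable K (Filter.Eventually.of_forall h)

lemma aux_deriv {Z : Type*} [MeasurableSpace Z] (P : Measure Z) [IsFiniteMeasure P]
    (h h' : ℝ → Z → ℝ) (B C : ℝ)
    (hm : ∀ t, Measurable (h t)) (hd : ∀ t z, HasDerivAt (fun s => h s z) (h' t z) t)
    (hB : ∀ t z, |h t z| ≤ B) (hC : ∀ t z, |h' t z| ≤ C) (t : ℝ) :
    HasDerivAt (fun s => ∫ z, h s z ∂P) (∫ z, h' t z ∂P) t :=
  (hasDerivAt_integral_of_dominated_loc_of_deriv_le (bound := fun _ => C) (s := Set.univ)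
    Filter.univ_mem
    (Filter.Eventually.of_forall fun s => (hm s).aestronglyMeasurable)
    (aux_int P _ (hm t) B (hB t))
    (aux_meas_deriv h (h' t) t hm (hd t)).aestronglyMeasurable
    (Filter.Eventually.of_forall fun z s _ => hC s z)
    (integrable_const _)
    (Filter.Eventually.of_forall fun z s _ => hd s z)).2

lemma aux_cov_le {Z : Type*} [MeasurableSpace Z] (Q : Measure Z) [IsProbabilityMeasure Q]
    (X Y : Z → ℝ) (hX : Measurable X) (hY : Measurable Y) (K : ℝ)
    (hXK : ∀ z, |X z| ≤ K) (hYK : ∀ z, |Y z| ≤ K) :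
    ∫ z, X z * Y z ∂Q - (∫ z, X z ∂Q) * (∫ z, Y z ∂Q) ≤ K ^ 2 := by
  have iX := aux_int Q X hX K hXK
  have iY := aux_int Q Y hY K hYK
  have iXY : Integrable (fun z => X z * Y z) Q := aux_int Q _ (hX.mul hY) (K * K) fun z => by
    rw [abs_mul]
    exact mul_le_mul (hXK z) (hYK z) (abs_nonneg _) ((abs_nonneg _).trans (hXK z))
  set c := ∫ z, X z ∂Q with hc
  set e := ∫ z, Y z ∂Q with he
  -- pointwise: X Y ≤ K² - ((X - Y)/2)², and ((X-Y)/2)² ≥ 2 m (X-Y)/2 - m²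
  have key : ∫ z, X z * Y z ∂Q ≤ ∫ z, (K ^ 2 + ((c - e) / 2) ^ 2
      - (c - e) / 2 * (X z - Y z)) ∂Q := by
    apply integral_mono iXY
    · exact (integrable_const _).sub ((iX.sub iY).const_mul _)
    · intro z
      have h1 := abs_le.1 (hXK z)
      have h2 := abs_le.1 (hYK z)
      have h3 : ((X z + Y z) / 2) ^ 2 ≤ K ^ 2 := by
        apply sq_le_sq'  <;> linarith
      simp only
      nlinarith [sq_nonneg ((X z - Y z) / 2 - (c - e) / 2)]
  have e1 : ∫ z, (K ^ 2 + ((c - e) / 2) ^ 2 - (c - e) / 2 * (X z - Y z)) ∂Q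
      = K ^ 2 + ((c - e) / 2) ^ 2 - (c - e) / 2 * (c - e) := by
    have i3 : Integrable (fun z => (c - e) / 2 * (X z - Y z)) Q := (iX.sub iY).const_mul _
    rw [integral_sub (integrable_const _) i3, integral_const_mul,
      integral_sub iX iY]
    simp [← hc, ← he]
  rw [e1] at key
  nlinarith [sq_nonneg (c + e)]

lemma aux_cov {Z : Type*} [MeasurableSpace Z] (Q : Measure Z) [IsProbabilityMeasure Q]
    (X Y : Z → ℝ) (hX : Measurable X) (hY : Measurable Y) (K : ℝ)
    (hXK : ∀ z, |X z| ≤ K) (hYK : ∀ z, |Y z| ≤ K) :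
    |∫ z, X z * Y z ∂Q - (∫ z, X z ∂Q) * (∫ z, Y z ∂Q)| ≤ K ^ 2 := by
  have h1 := aux_cov_le Q X Y hX hY K hXK hYK
  have h2 := aux_cov_le Q X (fun z => - Y z) hX hY.neg K hXK (fun z => by simpa using hYK z)
  simp only [mul_neg, integral_neg] at h2
  rw [abs_le]
  constructor <;> linarith

lemma aux_core {Z : Type*} [MeasurableSpace Z] (P : Measure Z) [IsProbabilityMeasure P]
    (a a' b b' : ℝ → Z → ℝ) (M K H : ℝ)
    (ham : ∀ t, Measurable (a t)) (hbm : ∀ t, Measurable (b t))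
    (had : ∀ t z, HasDerivAt (fun s => a s z) (a' t z) t)
    (hbd : ∀ t z, HasDerivAt (fun s => b s z) (b' t z) t)
    (haM : ∀ t z, |a t z| ≤ M) (haK : ∀ t z, |a' t z| ≤ K)
    (hbK : ∀ t z, |b t z| ≤ K) (hbH : ∀ t z, |b' t z| ≤ H) (T : ℝ) :
    |(∫ z, exp (a T z) * b T z ∂P) / (∫ z, exp (a T z) ∂P)
      - (∫ z, exp (a 0 z) * b 0 z ∂P) / (∫ z, exp (a 0 z) ∂P)| ≤ (H + K ^ 2) * |T| := by
  have hexp : ∀ t z, exp (a t z) ≤ exp M := fun t z =>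
    exp_le_exp.2 ((le_abs_self _).trans (haM t z))
  obtain ⟨z0⟩ : Nonempty Z := P.nonempty_of_neZero
  have hK0 : 0 ≤ K := (abs_nonneg _).trans (haK 0 z0)
  have ham' : ∀ t, Measurable (a' t) := fun t => aux_meas_deriv a (a' t) t ham (had t)
  have hbm' : ∀ t, Measurable (b' t) := fun t => aux_meas_deriv b (b' t) t hbm (hbd t)
  have iE : ∀ t, Integrable (fun z => exp (a t z)) P := fun t =>
    aux_int P _ (ham t).exp (exp M) fun z => by rw [abs_of_pos (exp_pos _)]; exact hexp t z
  have hDpos : ∀ t, 0 < ∫ z, exp (a t z) ∂P := fun t => integral_exp_pos (iE t)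
  have hD : ∀ t, HasDerivAt (fun s => ∫ z, exp (a s z) ∂P)
      (∫ z, exp (a t z) * a' t z ∂P) t := fun t => by
    refine aux_deriv P (fun s z => exp (a s z)) (fun s z => exp (a s z) * a' s z) (exp M)
      (exp M * K) (fun s => (ham s).exp) (fun s z => (had s z).exp) (fun s z => ?_)
      (fun s z => ?_) t
    · rw [abs_of_pos (exp_pos _)]; exact hexp s z
    · rw [abs_mul, abs_of_pos (exp_pos _)]
      exact mul_le_mul (hexp s z) (haK s z) (abs_nonneg _) (exp_pos _).le
  have hbnd : ∀ t z, |a' t z * b t z + b' t z| ≤ K * K + H := fun t z => by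
    refine (abs_add_le _ _).trans (add_le_add ?_ (hbH t z))
    rw [abs_mul]
    exact mul_le_mul (haK t z) (hbK t z) (abs_nonneg _) hK0
  have hN : ∀ t, HasDerivAt (fun s => ∫ z, exp (a s z) * b s z ∂P)
      (∫ z, exp (a t z) * (a' t z * b t z + b' t z) ∂P) t := fun t => by
    refine aux_deriv P (fun s z => exp (a s z) * b s z)
      (fun s z => exp (a s z) * (a' s z * b s z + b' s z)) (exp M * K)
      (exp M * (K * K + H)) (fun s => (ham s).exp.mul (hbm s)) (fun s z => ?_) (fun s z => ?_)
      (fun s z => ?_) t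
    · exact ((had s z).exp.mul (hbd s z)).congr_deriv (by ring)
    · rw [abs_mul, abs_of_pos (exp_pos _)]
      exact mul_le_mul (hexp s z) (hbK s z) (abs_nonneg _) (exp_pos _).le
    · rw [abs_mul, abs_of_pos (exp_pos _)]
      exact mul_le_mul (hexp s z) (hbnd s z) (abs_nonneg _) (exp_pos _).le
  have hφ := fun t => (hN t).div (hD t) (hDpos t).ne'
  have := Convex.norm_image_sub_le_of_norm_hasDerivWithin_le (s := Set.univ) (x := (0 : ℝ)) (y := T)
    (C := H + K ^ 2) (fun t _ => (hφ t).hasDerivWithinAt) (fun t _ => ?_) convex_univ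
    (Set.mem_univ _) (Set.mem_univ _)
  · simpa [Real.norm_eq_abs] using this
  · have hQ : IsProbabilityMeasure (P.tilted (a t)) := isProbabilityMeasure_tilted (iE t)
    have tl : ∀ g : Z → ℝ, ∫ z, g z ∂(P.tilted (a t))
        = (∫ z, exp (a t z) * g z ∂P) / ∫ z, exp (a t z) ∂P := fun g => by
      rw [integral_tilted, ← integral_div]
      congr 1
      ext z
      simp only [smul_eq_mul]
      ring
    have i1 : Integrable (fun z => a' t z * b t z) (P.tilted (a t)) :=
      aux_int _ _ ((ham' t).mul (hbm t)) (K * K) fun z => by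
        rw [abs_mul]
        exact mul_le_mul (haK t z) (hbK t z) (abs_nonneg _) hK0
    have i2 : Integrable (b' t) (P.tilted (a t)) := aux_int _ _ (hbm' t) H (hbH t)
    have hc := aux_cov (P.tilted (a t)) (a' t) (b t) (ham' t) (hbm t) K (haK t) (hbK t)
    have hH : |∫ z, b' t z ∂(P.tilted (a t))| ≤ H := by
      have := norm_integral_le_of_norm_le_const (μ := P.tilted (a t)) (f := b' t) (C := H)
        (Filter.Eventually.of_forall (hbH t))
      simpa using this
    have hadd := integral_add i1 i2
    have e := tl (fun z => a' t z * b t z + b' t z)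
    have e1 := tl (a' t)
    have e2 := tl (b t)
    have hp := (hDpos t).ne'
    have : (∫ z, exp (a t z) * (a' t z * b t z + b' t z) ∂P) * (∫ z, exp (a t z) ∂P)
        - (∫ z, exp (a t z) * b t z ∂P) * (∫ z, exp (a t z) * a' t z ∂P)
        = ((∫ z, a' t z * b t z ∂(P.tilted (a t)) - (∫ z, a' t z ∂(P.tilted (a t)))
          * (∫ z, b t z ∂(P.tilted (a t)))) + ∫ z, b' t z ∂(P.tilted (a t)))
          * (∫ z, exp (a t z) ∂P) ^ 2 := by
      have : ∫ z, a' t z * b t z ∂(P.tilted (a t)) = (∫ z, exp (a t z) * (a' t z * b t z + b' t z) ∂P)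
          / (∫ z, exp (a t z) ∂P) - ∫ z, b' t z ∂(P.tilted (a t)) := by
        rw [← e, hadd]; ring
      rw [this, e1, e2]
      field_simp
      ring
    rw [this, mul_div_assoc, div_self (pow_ne_zero 2 hp), mul_one, Real.norm_eq_abs]
    refine (abs_add_le _ _).trans ?_
    linarith

lemma aux_meas_grad {Z : Type*} [MeasurableSpace Z] (d : ℕ)
    (g : Z → EuclideanSpace ℝ (Fin d))
    (h : ∀ v, Measurable fun z => inner ℝ (g z) v) : Measurable g := by
  have : g = fun z => ∑ i, inner ℝ (g z) (EuclideanSpace.basisFun (Fin d) ℝ i) •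
      EuclideanSpace.basisFun (Fin d) ℝ i := by
    ext1 z
    conv_lhs => rw [← (EuclideanSpace.basisFun (Fin d) ℝ).sum_repr' (g z)]
    simp only [real_inner_comm]
  rw [this]
  exact Finset.measurable_sum _ fun i _ => (h _).smul_const _

/-- Smoothness of the log-sum-exp robust objective: under uniform bounds `M`, `G`, `L`
on the instance losses, their gradients and their Hessians, the gradient of
`f(θ) = log ∫ exp(l(θ,z)/λ) dP` is Lipschitz with constant `L/λ + G²/λ²`. -/
theorem logSumExp_gradient_lipschitz
    {Z : Type*} [MeasurableSpace Z] (P : Measure Z) [IsProbabilityMeasure P]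
    (d : ℕ) (lam : ℝ) (hlam : 0 < lam)
    (l : EuclideanSpace ℝ (Fin d) → Z → ℝ)
    (hmeas : ∀ θ, Measurable (fun z => l θ z))
    (hsmooth : ∀ z, ContDiff ℝ 2 (fun θ => l θ z))
    (M : ℝ) (hM : ∀ θ z, |l θ z| ≤ M)
    (G : ℝ) (hG : ∀ θ z, ‖gradient (fun θ' => l θ' z) θ‖ ≤ G)
    (L : ℝ) (hL : ∀ θ z, ‖fderiv ℝ (fun θ' => gradient (fun θ'' => l θ'' z) θ') θ‖ ≤ L)
    (f : EuclideanSpace ℝ (Fin d) → ℝ)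
    (hf : f = fun θ => Real.log (∫ z, Real.exp (l θ z / lam) ∂P)) :
    ∀ θ₁ θ₂, ‖gradient f θ₁ - gradient f θ₂‖
      ≤ (L / lam + G ^ 2 / lam ^ 2) * ‖θ₁ - θ₂‖ := by
  have hnz : Nonempty Z := P.nonempty_of_neZero
  obtain ⟨z0⟩ := hnz
  set g : EuclideanSpace ℝ (Fin d) → Z → EuclideanSpace ℝ (Fin d) :=
    fun θ z => gradient (fun θ' => l θ' z) θ with hgdef
  have hG0 : 0 ≤ G := (norm_nonneg _).trans (hG 0 z0)
  have hL0 : 0 ≤ L := (norm_nonneg _).trans (hL 0 z0)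
  have hgr : ∀ θ z, HasFDerivAt (fun θ' => l θ' z) (innerSL ℝ (g θ z)) θ := fun θ z =>
    ((hsmooth z).differentiable (by norm_num) θ).hasGradientAt.hasFDerivAt
  have hgd : ∀ z, Differentiable ℝ (fun θ => g θ z) := fun z => by
    have h1 : ContDiff ℝ 1 (fderiv ℝ (fun θ => l θ z)) :=
      (hsmooth z).fderiv_right (by norm_num)
    have h2 := h1.differentiable (by norm_num)
    exact (InnerProductSpace.toDual ℝ (EuclideanSpace ℝ (Fin d))).symm.toContinuousLinearEquiv.differentiable.comp h2
  have hline : ∀ (θ u : EuclideanSpace ℝ (Fin d)) (t : ℝ),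
      HasDerivAt (fun s : ℝ => θ + s • u) u t := fun θ u t => by
    simpa using ((hasDerivAt_id t).smul_const u).const_add θ
  have had : ∀ θ u z t, HasDerivAt (fun s : ℝ => l (θ + s • u) z / lam)
      (inner ℝ (g (θ + t • u) z) u / lam) t := fun θ u z t => by
    have := ((hgr (θ + t • u) z).comp_hasDerivAt t (hline θ u t)).div_const lam
    simpa using this
  have hgm : ∀ θ v, Measurable fun z => inner ℝ (g θ z) v := fun θ v => by
    have := aux_meas_deriv (fun s z => l (θ + s • v) z / lam)
      (fun z => inner ℝ (g (θ + (0 : ℝ) • v) z) v / lam) 0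
      (fun s => (hmeas _).div_const lam) (fun z => had θ v z 0)
    have h2 := this.mul_const lam
    simpa [div_mul_cancel₀ _ hlam.ne'] using h2
  have hgM : ∀ θ, Measurable (g θ) := fun θ => aux_meas_grad d _ (hgm θ)
  have hexp : ∀ θ z, exp (l θ z / lam) ≤ exp (M / lam) := fun θ z => by
    apply exp_le_exp.2
    have := (le_abs_self _).trans (hM θ z)
    gcongr
  have iE : ∀ θ, Integrable (fun z => exp (l θ z / lam)) P := fun θ =>
    aux_int P _ ((hmeas θ).div_const lam).exp (exp (M / lam)) fun z => by
      rw [abs_of_pos (exp_pos _)]; exact hexp θ z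
  have hF'm : ∀ θ, AEStronglyMeasurable
      (fun z => (exp (l θ z / lam) / lam) • innerSL ℝ (g θ z)) P := fun θ => by
    have h1 : AEStronglyMeasurable (fun z => exp (l θ z / lam) / lam) P :=
      (((hmeas θ).div_const lam).exp.div_const lam).aestronglyMeasurable
    have h2 : AEStronglyMeasurable (fun z => innerSL ℝ (g θ z)) P :=
      (innerSL ℝ).continuous.comp_aestronglyMeasurable (hgM θ).aestronglyMeasurable
    exact h1.smul h2
  have hF'b : ∀ θ z, ‖(exp (l θ z / lam) / lam) • innerSL ℝ (g θ z)‖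
      ≤ exp (M / lam) / lam * G := fun θ z => by
    rw [norm_smul, innerSL_apply_norm, Real.norm_eq_abs, abs_of_pos (by positivity)]
    have h1 := hexp θ z
    have h2 : ‖g θ z‖ ≤ G := hG θ z
    gcongr
  have hD : ∀ θ, HasFDerivAt (fun θ => ∫ z, exp (l θ z / lam) ∂P)
      (∫ z, (exp (l θ z / lam) / lam) • innerSL ℝ (g θ z) ∂P) θ := fun θ => by
    refine hasFDerivAt_integral_of_dominated_of_fderiv_le (s := Set.univ)
      (F' := fun θ z => (exp (l θ z / lam) / lam) • innerSL ℝ (g θ z))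
      (bound := fun _ => exp (M / lam) / lam * G) Filter.univ_mem
      (Filter.Eventually.of_forall fun s => (iE s).aestronglyMeasurable) (iE θ) (hF'm θ)
      (Filter.Eventually.of_forall fun z s _ => hF'b s z) (integrable_const _)
      (Filter.Eventually.of_forall fun z s _ => ?_)
    have := ((hgr s z).mul_const lam⁻¹).exp
    simpa [div_eq_mul_inv, smul_smul] using this
  have hDpos : ∀ θ, 0 < ∫ z, exp (l θ z / lam) ∂P := fun θ => integral_exp_pos (iE θ)
  have hgf : ∀ θ v, inner ℝ (gradient f θ) v
      = (∫ z, exp (l θ z / lam) * (inner ℝ (g θ z) v / lam) ∂P)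
        / ∫ z, exp (l θ z / lam) ∂P := fun θ v => by
    have h1 := (hD θ).log (hDpos θ).ne'
    rw [← hf] at h1
    have h2 : inner ℝ (gradient f θ) v = fderiv ℝ f θ v := by
      simp [gradient]
    have hi : Integrable (fun z => (exp (l θ z / lam) / lam) • innerSL ℝ (g θ z)) P :=
      Integrable.of_bound (hF'm θ) _ (Filter.Eventually.of_forall (hF'b θ))
    rw [h2, h1.fderiv, ContinuousLinearMap.smul_apply, ContinuousLinearMap.integral_apply hi,
      smul_eq_mul, div_eq_inv_mul]
    congr 2
    ext z
    simp only [ContinuousLinearMap.smul_apply, innerSL_apply_apply, smul_eq_mul]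
    ring
  have hin : ∀ (x : EuclideanSpace ℝ (Fin d)) v, ‖x‖ ≤ G → ‖v‖ = 1 →
      |inner ℝ x v / lam| ≤ G / lam := fun x v hx hv => by
    rw [abs_div, abs_of_pos hlam]
    have := abs_real_inner_le_norm x v
    rw [hv, mul_one] at this
    have := this.trans hx
    gcongr
  have main : ∀ θ u v : EuclideanSpace ℝ (Fin d), ‖u‖ = 1 → ‖v‖ = 1 → ∀ T : ℝ,
      |inner ℝ (gradient f (θ + T • u) - gradient f θ) v|
        ≤ (L / lam + (G / lam) ^ 2) * |T| := fun θ u v hu hv T => by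
    have := aux_core P (fun t z => l (θ + t • u) z / lam)
      (fun t z => inner ℝ (g (θ + t • u) z) u / lam)
      (fun t z => inner ℝ (g (θ + t • u) z) v / lam)
      (fun t z => inner ℝ (fderiv ℝ (fun θ' => g θ' z) (θ + t • u) u) v / lam)
      (M / lam) (G / lam) (L / lam) (fun t => (hmeas _).div_const lam)
      (fun t => (hgm _ v).div_const lam) (fun t z => had θ u z t)
      (fun t z => ?_) (fun t z => ?_) (fun t z => hin _ _ (hG _ z) hu)
      (fun t z => hin _ _ (hG _ z) hv) (fun t z => ?_) T
    · rw [inner_sub_left, hgf, hgf]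
      simpa using this
    · have h1 := ((hgd z (θ + t • u)).hasFDerivAt).comp_hasDerivAt t (hline θ u t)
      have h2 := (h1.inner ℝ (hasDerivAt_const t v)).div_const lam
      simpa using h2
    · rw [abs_div, abs_of_pos hlam]
      have := hM (θ + t • u) z
      gcongr
    · rw [abs_div, abs_of_pos hlam]
      have h1 := abs_real_inner_le_norm (fderiv ℝ (fun θ' => g θ' z) (θ + t • u) u) v
      have h2 := (fderiv ℝ (fun θ' => g θ' z) (θ + t • u)).le_opNorm u
      have h3 := hL (θ + t • u) z
      rw [hv, mul_one] at h1
      rw [hu, mul_one] at h2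
      have := h1.trans (h2.trans h3)
      gcongr
  intro θ₁ θ₂
  by_cases hθ : θ₁ = θ₂
  · simp [hθ]
  by_cases hw : gradient f θ₁ - gradient f θ₂ = 0
  · rw [hw, norm_zero]
    positivity
  have hn1 : ‖θ₁ - θ₂‖ ≠ 0 := norm_ne_zero_iff.2 (sub_ne_zero.2 hθ)
  have hn2 := norm_ne_zero_iff.2 hw
  have := main θ₂ (‖θ₁ - θ₂‖⁻¹ • (θ₁ - θ₂))
    (‖gradient f θ₁ - gradient f θ₂‖⁻¹ • (gradient f θ₁ - gradient f θ₂))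
    (by rw [norm_smul, norm_inv, norm_norm, inv_mul_cancel₀ hn1])
    (by rw [norm_smul, norm_inv, norm_norm, inv_mul_cancel₀ hn2]) ‖θ₁ - θ₂‖
  rw [smul_smul, mul_inv_cancel₀ hn1, one_smul, add_sub_cancel, inner_smul_right,
    real_inner_self_eq_norm_sq, pow_two, inv_mul_cancel_left₀ hn2, abs_norm, abs_norm,
    div_pow] at this
  exact this
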